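/- For every integer n ≥ 1, the number of ascent sequences of length n that avoid both of the patterns 0121 and 1032 equals the Catalan number C_n = (1/(n+1))·binom(2n,n). -/

import Mathlib

/-- The number of ascents of a word of nonnegative integers. -/
def numAscents (w : List ℕ) : ℕ :=
  (w.zip w.tail).countP (fun p => p.1 < p.2)

/-- A word of nonnegative integers is an ascent sequence if it starts with 0 and
each subsequent entry is at most one more than the number of ascents preceding it. -/
def IsAscentSeq (w : List ℕ) : Prop :=
  w.head? = some 0 ∧
    ∀ i (h : i < w.length), 1 ≤ i → w.get ⟨i, h⟩ ≤ numAscents (w.take i) + 1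

/-- A word `π` contains the pattern `τ` if it has a subsequence order-isomorphic to `τ`. -/
def Contains (π τ : List ℕ) : Prop :=
  ∃ f : Fin τ.length → Fin π.length, StrictMono f ∧
    ∀ i j, (π.get (f i) < π.get (f j) ↔ τ.get i < τ.get j) ∧
      (π.get (f i) > π.get (f j) ↔ τ.get i > τ.get j)

/-- A word avoids a pattern if it does not contain it. -/
def Avoids (π τ : List ℕ) : Prop := ¬ Contains π τ

/-- The number of ascent sequences of length `n` avoiding every pattern in `T`. -/
noncomputable def avoiderCount (n : ℕ) (T : List (List ℕ)) : ℕ :=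
  {w : List ℕ | w.length = n ∧ IsAscentSeq w ∧ ∀ τ ∈ T, Avoids w τ}.ncard

namespace AscentSeq

open PowerSeries

/-- `b` may follow `a` in a word whose nonzero entries are weakly increasing. -/
def ZeroOrLE (a b : ℕ) : Prop := b = 0 ∨ a ≤ b

/-- An ascent sequence whose nonzero entries are weakly increasing. -/
def IsNonzeroMono (w : List ℕ) : Prop := IsAscentSeq w ∧ w.Pairwise ZeroOrLE

lemma numAscents_cons_cons (a b : ℕ) (t : List ℕ) :
    numAscents (a :: b :: t) = numAscents (b :: t) + if a < b then 1 else 0 := by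
  simp [numAscents, List.countP_cons]

lemma numAscents_append_pair (p : List ℕ) (l v : ℕ) :
    numAscents (p ++ [l, v]) = numAscents (p ++ [l]) + if l < v then 1 else 0 := by
  induction p with
  | nil => simp [numAscents]
  | cons a p ih =>
    cases p with
    | nil =>
      rw [List.cons_append, List.nil_append, numAscents_cons_cons]
      simp [numAscents, List.countP_cons]
      omega
    | cons b p =>
      simp only [List.cons_append, numAscents_cons_cons] at ih ⊢
      omega

lemma numAscents_add_head_le {x M : ℕ} {q : List ℕ} (hmono : (x :: q).Pairwise (· ≤ ·))
    (hM : ∀ y ∈ x :: q, y ≤ M) : numAscents (x :: q) + x ≤ M := by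
  induction q generalizing x with
  | nil => simpa [numAscents] using hM
  | cons b q ih =>
    have h := ih hmono.tail fun y hy => hM y (List.mem_cons_of_mem _ hy)
    have hxb : x ≤ b := List.rel_of_pairwise_cons hmono (by simp)
    rw [numAscents_cons_cons]
    split_ifs <;> omega

lemma le_numAscents_of_append_cons {q r : List ℕ} {d : ℕ} (hq : q ≠ [])
    (h : IsAscentSeq (q ++ d :: r)) : d ≤ numAscents q + 1 := by
  have := h.2 q.length (by simp) (List.length_pos_iff.2 hq)
  simpa using this

lemma isAscentSeq_of_append {p s : List ℕ} (hp : p ≠ []) (h : IsAscentSeq (p ++ s)) :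
    IsAscentSeq p := by
  refine ⟨?_, fun i hi h1 => ?_⟩
  · have := h.1
    rwa [List.head?_append_of_ne_nil _ hp] at this
  · have := h.2 i (by simp; omega) h1
    rwa [List.take_append_of_le_length hi.le, List.get_eq_getElem,
      List.getElem_append_left hi] at this

lemma isAscentSeq_append_singleton {p : List ℕ} {v : ℕ} (hp : p ≠ []) :
    IsAscentSeq (p ++ [v]) ↔ IsAscentSeq p ∧ v ≤ numAscents p + 1 := by
  refine ⟨fun h => ⟨isAscentSeq_of_append hp h, le_numAscents_of_append_cons hp h⟩, ?_⟩
  rintro ⟨h, hv⟩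
  refine ⟨by rw [List.head?_append_of_ne_nil _ hp]; exact h.1, fun i hi h1 => ?_⟩
  rcases Nat.lt_or_ge i p.length with hip | hip
  · rw [List.take_append_of_le_length hip.le, List.get_eq_getElem, List.getElem_append_left hip]
    exact h.2 i hip h1
  · obtain rfl : i = p.length := by simp at hi; omega
    simpa using hv

lemma contains_of_sublist {w τ l : List ℕ} (hl : l.Sublist w) (hlen : τ.length = l.length)
    (h : ∀ i j : Fin τ.length,
      (l.get (i.cast hlen) < l.get (j.cast hlen) ↔ τ.get i < τ.get j)) :
    Contains w τ := by
  obtain ⟨f, hf⟩ := List.sublist_iff_exists_fin_orderEmbedding_get_eq.1 hl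
  refine ⟨fun i => f (i.cast hlen), fun i j hij => f.strictMono (by simpa using hij),
    fun i j => ?_⟩
  simp only [gt_iff_lt, ← hf]
  exact ⟨h i j, h j i⟩

lemma contains_0121 {w : List ℕ} {b c : ℕ} (hb : 0 < b) (hc : b < c)
    (h : [0, b, c, b].Sublist w) : Contains w [0, 1, 2, 1] := by
  refine contains_of_sublist h rfl fun i j => ?_
  fin_cases i <;> fin_cases j <;> simp <;> omega

lemma contains_1032 {w : List ℕ} {b c d : ℕ} (hb : 0 < b) (hc : b < c) (hd : c < d)
    (h : [b, 0, d, c].Sublist w) : Contains w [1, 0, 3, 2] := by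
  refine contains_of_sublist h rfl fun i j => ?_
  fin_cases i <;> fin_cases j <;> simp <;> omega

lemma Contains.of_append {p s τ : List ℕ} (h : Contains p τ) : Contains (p ++ s) τ := by
  obtain ⟨f, hf, h⟩ := h
  refine ⟨fun i => (f i).castLE (by simp), fun i j hij => hf hij, fun i j => ?_⟩
  simpa [List.getElem_append_left] using h i j

lemma pairwise_zeroOrLE_of_avoids {w : List ℕ} (hw : IsAscentSeq w)
    (h1 : Avoids w [0, 1, 2, 1]) (h2 : Avoids w [1, 0, 3, 2]) : w.Pairwise ZeroOrLE := by
  induction w using List.reverseRecOn with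
  | nil => simp
  | append_singleton p v ih =>
    rcases eq_or_ne p [] with rfl | hp
    · simp
    have hpa := isAscentSeq_of_append hp hw
    have hmono := ih hpa (fun h => h1 (Contains.of_append h)) fun h => h2 (Contains.of_append h)
    rw [List.pairwise_append]
    refine ⟨hmono, by simp, fun x hx y hy => ?_⟩
    obtain rfl : y = v := by simpa using hy
    by_contra hxy
    obtain ⟨hy0, hyx⟩ : y ≠ 0 ∧ y < x := by simpa [ZeroOrLE] using hxy
    obtain ⟨d, hd⟩ : ∃ d, p.find? (fun z => decide (y < z)) = some d :=
      Option.isSome_iff_exists.1 (List.find?_isSome.2 ⟨x, hx, by simpa⟩)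
    obtain ⟨hyd, q, r, rfl, hq⟩ := List.find?_eq_some_iff_append.1 hd
    simp only [decide_eq_true_eq, Bool.not_eq_true', decide_eq_false_iff_not, not_lt] at hyd hq
    obtain ⟨q, rfl⟩ : ∃ q', q = 0 :: q' := by
      cases q with
      | nil => have := hpa.1; simp at this; omega
      | cons a q => have := hpa.1; simp at this; exact ⟨q, by rw [this]⟩
    have hdy : [d, y].Sublist (d :: r ++ [y]) := by
      simp
    by_cases hyq : y ∈ q
    · refine h1 (contains_0121 (Nat.pos_of_ne_zero hy0) hyd (?_ : [0, y, d, y].Sublist _))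
      have : [0, y].Sublist (0 :: q) := by simpa
      simpa using this.append hdy
    have hlt : ∀ z ∈ q, z < y := fun z hz =>
      lt_of_le_of_ne (hq z (by simp [hz])) (by rintro rfl; exact hyq hz)
    have hasc := le_numAscents_of_append_cons (by simp) hpa
    by_cases hqm : (0 :: q).Pairwise (· ≤ ·)
    · have := numAscents_add_head_le (M := y - 1) hqm (by
        intro z hz
        rcases List.mem_cons.1 hz with rfl | hz
        · omega
        · have := hlt z hz; omega)
      omega
    · rw [List.pairwise_iff_forall_sublist] at hqm
      push Not at hqm
      obtain ⟨b, a, hab, hlt'⟩ := hqm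
      have hR := List.pairwise_iff_forall_sublist.1 (List.pairwise_append.1 hmono).1 hab
      obtain rfl : a = 0 := by rcases hR with h | h <;> omega
      have hbq : b ∈ q := by
        have : b ∈ 0 :: q := hab.subset (by simp)
        rcases List.mem_cons.1 this with rfl | h
        · omega
        · exact h
      refine h2 (contains_1032 hlt' (hlt b hbq) hyd (?_ : [b, 0, d, y].Sublist _))
      simpa using hab.append hdy

lemma avoids_of_pairwise {w τ : List ℕ} (hw : w.Pairwise ZeroOrLE)
    (hτ : ∃ i j k : Fin τ.length, j < k ∧ τ.get k < τ.get j ∧ τ.get i < τ.get k) :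
    Avoids w τ := by
  rintro ⟨f, hf, h⟩
  obtain ⟨i, j, k, hjk, h1, h2⟩ := hτ
  have h1' := (h k j).1.2 h1
  have h2' := (h i k).1.2 h2
  rcases List.pairwise_iff_get.1 hw _ _ (hf hjk) with h | h <;> omega

lemma avoids_iff_pairwise {w : List ℕ} (hw : IsAscentSeq w) :
    (∀ τ ∈ [[0, 1, 2, 1], [1, 0, 3, 2]], Avoids w τ) ↔ w.Pairwise ZeroOrLE := by
  constructor
  · intro h
    exact pairwise_zeroOrLE_of_avoids hw (h _ (by simp)) (h _ (by simp))
  · intro h τ hτ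
    simp only [List.mem_cons, List.not_mem_nil, or_false] at hτ
    rcases hτ with rfl | rfl
    · exact avoids_of_pairwise h ⟨0, 2, 3, by decide⟩
    · exact avoids_of_pairwise h ⟨0, 2, 3, by decide⟩

/-- The words of length `n` that extend an ascent sequence with `a` ascents, maximum `m` and last
entry `l` to one whose nonzero entries are weakly increasing, if those of the given sequence are. -/
def extensions : ℕ → ℕ → ℕ → ℕ → Finset (List ℕ)
  | 0, _, _, _ => {[]}
  | n + 1, a, m, l =>
    (extensions n a m 0).image (List.cons 0) ∪
      (Finset.Icc (max m 1) (a + 1)).biUnion fun v =>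
        (extensions n (a + if l < v then 1 else 0) v v).image (List.cons v)

lemma cons_mem_extensions {n a m l v : ℕ} {s : List ℕ} :
    v :: s ∈ extensions (n + 1) a m l ↔
      (v = 0 ∧ s ∈ extensions n a m 0) ∨
        (v ≠ 0 ∧ m ≤ v ∧ v ≤ a + 1 ∧ s ∈ extensions n (a + if l < v then 1 else 0) v v) := by
  simp only [extensions, Finset.mem_union, Finset.mem_image, Finset.mem_biUnion, Finset.mem_Icc,
    List.cons.injEq]
  constructor
  · rintro (⟨t, ht, rfl, rfl⟩ | ⟨x, hx, t, ht, rfl, rfl⟩)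
    · exact .inl ⟨rfl, ht⟩
    · exact .inr ⟨by omega, by omega, by omega, ht⟩
  · rintro (⟨rfl, h⟩ | ⟨h0, h1, h2, h⟩)
    · exact .inl ⟨s, h, rfl, rfl⟩
    · exact .inr ⟨v, by omega, s, h, rfl, rfl⟩

lemma length_of_mem_extensions {n a m l : ℕ} {s : List ℕ} (h : s ∈ extensions n a m l) :
    s.length = n := by
  induction n generalizing a m l s with
  | zero => simpa [extensions] using h
  | succ n ih =>
    cases s with
    | nil => simp [extensions] at h
    | cons v s => rcases cons_mem_extensions.1 h with h | h <;> simp [ih (by tauto)]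

lemma isNonzeroMono_of_append {p s : List ℕ} (hp : p ≠ []) (h : IsNonzeroMono (p ++ s)) :
    IsNonzeroMono p :=
  ⟨isAscentSeq_of_append hp h.1, (List.pairwise_append.1 h.2).1⟩

lemma isNonzeroMono_append_singleton {p : List ℕ} {v : ℕ} (hp : p ≠ []) :
    IsNonzeroMono (p ++ [v]) ↔
      IsNonzeroMono p ∧ v ≤ numAscents p + 1 ∧ ∀ x ∈ p, ZeroOrLE x v := by
  simp only [IsNonzeroMono, isAscentSeq_append_singleton hp, List.pairwise_append]
  simp
  tauto

lemma isNonzeroMono_append_iff {p s : List ℕ} {l m : ℕ} (hp : IsNonzeroMono (p ++ [l]))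
    (hm : m ∈ p ++ [l]) (hmax : ∀ x ∈ p ++ [l], x ≤ m) :
    IsNonzeroMono (p ++ [l] ++ s) ↔ s ∈ extensions s.length (numAscents (p ++ [l])) m l := by
  induction s generalizing p l m with
  | nil => simpa [extensions] using hp
  | cons v s ih =>
    have hstep := isNonzeroMono_append_singleton (p := p ++ [l]) (v := v) (by simp)
    have hnum : numAscents (p ++ [l] ++ [v]) =
        numAscents (p ++ [l]) + if l < v then 1 else 0 := by
      simpa using numAscents_append_pair p l v
    rw [List.append_cons, List.length_cons, cons_mem_extensions]
    constructor
    · intro h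
      have hv := isNonzeroMono_of_append (by simp) h
      obtain ⟨-, hle, hR⟩ := hstep.1 hv
      rcases Nat.eq_zero_or_pos v with rfl | hpos
      · left
        have := (ih hv (List.mem_append_left _ hm) (by
          intro x hx
          rcases List.mem_append.1 hx with hx | hx
          · exact hmax x hx
          · simp at hx; omega)).1 h
        rw [hnum] at this
        exact ⟨rfl, by simpa using this⟩
      · right
        have hle' : ∀ x ∈ p ++ [l], x ≤ v := fun x hx => (hR x hx).resolve_left hpos.ne'
        have := (ih (m := v) hv (by simp) (by
          intro x hx
          rcases List.mem_append.1 hx with hx | hx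
          · exact hle' x hx
          · simp at hx; omega)).1 h
        rw [hnum] at this
        exact ⟨hpos.ne', hle' m hm, hle, this⟩
    · rintro (⟨rfl, h⟩ | ⟨h0, hmv, hle, h⟩)
      · have hv := hstep.2 ⟨hp, by omega, fun x _ => .inl rfl⟩
        refine (ih (m := m) hv (List.mem_append_left _ hm) ?_).2 (by rw [hnum]; simpa using h)
        intro x hx
        rcases List.mem_append.1 hx with hx | hx
        · exact hmax x hx
        · simp at hx; omega
      · have hv := hstep.2 ⟨hp, hle, fun x hx => .inr ((hmax x hx).trans hmv)⟩
        refine (ih (m := v) hv (by simp) ?_).2 (by rw [hnum]; exact h)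
        intro x hx
        rcases List.mem_append.1 hx with hx | hx
        · exact (hmax x hx).trans hmv
        · simp at hx; omega

lemma isNonzeroMono_cons_zero_iff {s : List ℕ} :
    IsNonzeroMono (0 :: s) ↔ s ∈ extensions s.length 0 0 0 := by
  have h0 : IsNonzeroMono ([] ++ [0]) := by
    refine ⟨⟨by simp, fun i hi h1 => ?_⟩, by simp⟩
    simp at hi
    omega
  simpa [numAscents] using isNonzeroMono_append_iff (s := s) (m := 0) h0 (by simp) (by simp)

lemma card_extensions_succ (n a m l : ℕ) :
    (extensions (n + 1) a m l).card = (extensions n a m 0).card +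
      ∑ v ∈ Finset.Icc (max m 1) (a + 1),
        (extensions n (a + if l < v then 1 else 0) v v).card := by
  rw [extensions, Finset.card_union_of_disjoint, Finset.card_biUnion,
    Finset.card_image_of_injective _ List.cons_injective]
  · congr 1
    exact Finset.sum_congr rfl fun v _ => Finset.card_image_of_injective _ List.cons_injective
  · intro v _ v' _ hne
    rw [Function.onFun, Finset.disjoint_left]
    simp only [Finset.mem_image]
    rintro _ ⟨s, _, rfl⟩ ⟨t, _, h⟩
    exact hne (List.cons.inj h).1.symm
  · rw [Finset.disjoint_left]
    simp only [Finset.mem_image, Finset.mem_biUnion, Finset.mem_Icc]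
    rintro _ ⟨s, _, rfl⟩ ⟨v, hv, t, _, h⟩
    have := (List.cons.inj h).1
    omega

/-- The generating function of the Catalan numbers, with integer coefficients. -/
noncomputable def catalanGF : ℤ⟦X⟧ := catalanSeries.map (Nat.castRingHom ℤ)

lemma coeff_catalanGF (n : ℕ) : coeff n catalanGF = catalan n := by
  simp [catalanGF]

lemma X_mul_catalanGF_sq : X * catalanGF ^ 2 = catalanGF - 1 := by
  have h := congrArg (PowerSeries.map (Nat.castRingHom ℤ)) catalanSeries_sq_mul_X_add_one
  rw [map_add, map_mul, map_pow, map_one, map_X] at h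
  change catalanGF ^ 2 * X + 1 = catalanGF at h
  linear_combination h

/-- The factor by which generating functions of extensions grow with the ascent slack. -/
noncomputable def slackGF : ℤ⟦X⟧ := catalanGF ^ 2 - catalanGF + 1

lemma X_mul_sum_slackGF (k : ℕ) :
    X * ∑ j ∈ Finset.range k, catalanGF ^ 3 * slackGF ^ j = slackGF ^ k - 1 := by
  induction k with
  | zero => simp
  | succ k ih =>
    rw [Finset.sum_range_succ, mul_add, ih]
    have : slackGF = catalanGF ^ 2 - catalanGF + 1 := rfl
    linear_combination catalanGF * slackGF ^ k * X_mul_catalanGF_sq - slackGF ^ k * this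

lemma slackGF_eq_of_zero (k : ℕ) :
    catalanGF ^ 2 * slackGF ^ k = 1 + X * (catalanGF ^ 2 * slackGF ^ k +
      ∑ j ∈ Finset.range (k + 1), catalanGF ^ 3 * slackGF ^ j) := by
  have : slackGF = catalanGF ^ 2 - catalanGF + 1 := rfl
  rw [mul_add, X_mul_sum_slackGF]
  linear_combination -slackGF ^ k * X_mul_catalanGF_sq - slackGF ^ k * this

lemma slackGF_eq_of_pos (k : ℕ) :
    catalanGF ^ 3 * slackGF ^ k = 1 + X * (catalanGF ^ 2 * slackGF ^ (k + 1) +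
      (catalanGF ^ 3 * slackGF ^ k +
        ∑ j ∈ Finset.range (k + 1), catalanGF ^ 3 * slackGF ^ j)) := by
  have : slackGF = catalanGF ^ 2 - catalanGF + 1 := rfl
  rw [mul_add, mul_add, X_mul_sum_slackGF]
  linear_combination -(slackGF ^ (k + 1) + catalanGF * slackGF ^ k) * X_mul_catalanGF_sq
    - slackGF ^ k * catalanGF * this

lemma coeff_succ_eq {F G : ℤ⟦X⟧} (h : F = 1 + X * G) (n : ℕ) : coeff (n + 1) F = coeff n G := by
  rw [h]
  simp [coeff_one, coeff_succ_X_mul]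

lemma coeff_zero_eq {F G : ℤ⟦X⟧} (h : F = 1 + X * G) : coeff 0 F = 1 := by
  rw [h]
  simp

lemma sum_Icc_sub {M : Type*} [AddCommMonoid M] (f : ℕ → M) {m a : ℕ} (h : m ≤ a + 1) :
    ∑ v ∈ Finset.Icc m a, f (a - v) = ∑ j ∈ Finset.range (a + 1 - m), f j := by
  refine Finset.sum_nbij' (fun v => a - v) (fun j => a - j) ?_ ?_ ?_ ?_ ?_ <;>
    simp only [Finset.mem_Icc, Finset.mem_range] <;> intros <;> first | trivial | omega

lemma card_extensions (n a m : ℕ) (hm : 1 ≤ m) (hma : m ≤ a) :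
    ((extensions n a m 0).card : ℤ) = coeff n (catalanGF ^ 2 * slackGF ^ (a - m + 1)) ∧
      ((extensions n a m m).card : ℤ) = coeff n (catalanGF ^ 3 * slackGF ^ (a - m)) := by
  induction n generalizing a m with
  | zero =>
    rw [coeff_zero_eq (slackGF_eq_of_zero _), coeff_zero_eq (slackGF_eq_of_pos _)]
    simp [extensions]
  | succ n ih =>
    have hmax : max m 1 = m := by omega
    rw [card_extensions_succ, card_extensions_succ, hmax,
      coeff_succ_eq (slackGF_eq_of_zero _), coeff_succ_eq (slackGF_eq_of_pos _)]
    push_cast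
    rw [(ih a m hm hma).1]
    simp only [map_add, map_sum]
    refine ⟨congrArg _ ?_, congrArg _ ?_⟩
    · have hs := sum_Icc_sub (fun j => coeff n (catalanGF ^ 3 * slackGF ^ j))
        (m := m) (a := a + 1) (by omega)
      rw [show a - m + 1 + 1 = a + 1 + 1 - m by omega, ← hs]
      refine Finset.sum_congr rfl fun v hv => ?_
      rw [Finset.mem_Icc] at hv
      rw [if_pos (by omega), (ih (a + 1) v (by omega) (by omega)).2]
    · have hs := sum_Icc_sub (fun j => coeff n (catalanGF ^ 3 * slackGF ^ j))
        (m := m + 1) (a := a + 1) (by omega)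
      rw [show a - m + 1 = a + 1 + 1 - (m + 1) by omega, ← hs,
        ← Finset.add_sum_Ioc_eq_sum_Icc (by omega : m ≤ a + 1)]
      rw [if_neg (lt_irrefl m), add_zero, (ih a m hm hma).2]
      have hIoc : Finset.Ioc m (a + 1) = Finset.Icc (m + 1) (a + 1) := by
        ext
        simp only [Finset.mem_Ioc, Finset.mem_Icc]
        omega
      refine congrArg _ (Finset.sum_congr hIoc fun v hv => ?_)
      rw [Finset.mem_Icc] at hv
      rw [if_pos (by omega), (ih (a + 1) v (by omega) (by omega)).2]

lemma card_extensions_zero (n : ℕ) :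
    ((extensions n 0 0 0).card : ℤ) = coeff n (catalanGF ^ 2) := by
  have h0 : catalanGF ^ 2 = 1 + X * (catalanGF ^ 2 + catalanGF ^ 3) := by
    simpa using slackGF_eq_of_zero 0
  induction n with
  | zero => rw [coeff_zero_eq h0]; simp [extensions]
  | succ n ih =>
    rw [card_extensions_succ, coeff_succ_eq h0, map_add, ← ih]
    simpa using (card_extensions n 1 1 le_rfl le_rfl).2

lemma card_extensions_eq_catalan (n : ℕ) : (extensions n 0 0 0).card = catalan (n + 1) := by
  have h := congrArg (coeff (n + 1)) X_mul_catalanGF_sq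
  rw [coeff_succ_X_mul, ← card_extensions_zero] at h
  simpa [coeff_catalanGF, coeff_one] using h

end AscentSeq

open AscentSeq in
/-- The number of ascent sequences of length `n` avoiding both patterns equals
the Catalan number $C_n$. -/
theorem catalan_count_avoid_0121_1032 (n : ℕ) (hn : 1 ≤ n) :
    avoiderCount n [[0,1,2,1], [1,0,3,2]] = catalan n := by
  obtain ⟨n, rfl⟩ := Nat.exists_eq_add_of_le' hn
  have hset : {w : List ℕ | w.length = n + 1 ∧ IsAscentSeq w ∧
      ∀ τ ∈ [[0,1,2,1], [1,0,3,2]], Avoids w τ} =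
      ((extensions n 0 0 0).image (List.cons 0) : Finset (List ℕ)) := by
    ext w
    simp only [Set.mem_ofPred_eq, Finset.coe_image, Set.mem_image, Finset.mem_coe]
    constructor
    · rintro ⟨hlen, hasc, hav⟩
      cases w with
      | nil => simp at hlen
      | cons x s =>
        obtain rfl : x = 0 := by simpa using hasc.1
        obtain rfl : s.length = n := by simpa using hlen
        exact ⟨s, isNonzeroMono_cons_zero_iff.1 ⟨hasc, (avoids_iff_pairwise hasc).1 hav⟩, rfl⟩
    · rintro ⟨s, hs, rfl⟩
      obtain rfl := length_of_mem_extensions hs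
      have h := isNonzeroMono_cons_zero_iff.2 hs
      exact ⟨by simp, h.1, (avoids_iff_pairwise h.1).2 h.2⟩
  rw [avoiderCount, hset, Set.ncard_coe_finset,
    Finset.card_image_of_injective _ List.cons_injective, card_extensions_eq_catalan]
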